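/- arXiv:1403.4918 — 2 statements merged into one kernel-verified Lean document; each statement's English description precedes it below -/
import Mathlib

section
/- For a residuated lattice A, the following are equivalent: (1) A has the Boolean Lifting Property; (2) for all x ∈ A there exists e ∈ B(A) such that e ∈ [x) and ¬e ∈ [¬x); (3) for all x,y ∈ A with x ⊙ y = 0 there exists e ∈ B(A) such that e ∈ [x) and ¬e ∈ [y). -/
/-- A (commutative integral bounded) residuated lattice: a bounded lattice together
with a commutative monoid structure (whose unit is the top element) and a residuum
operation satisfying the law of residuation. -/
class ResiduatedLattice (A : Type*) extends Lattice A, BoundedOrder A, CommMonoid A where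
  rimp : A → A → A
  residuation : ∀ a b c : A, a ≤ rimp b c ↔ a * b ≤ c
  one_eq_top : (1 : A) = ⊤

namespace ResiduatedLattice

variable {A : Type*} [ResiduatedLattice A]

/-- Negation: ¬a = a → 0. -/
def rneg (a : A) : A := rimp a ⊥

/-- Biresiduum: d(a,b) = (a → b) ∧ (b → a). -/
def bires (a b : A) : A := rimp a b ⊓ rimp b a

/-- Membership in the Boolean center B(A): complemented elements of the bounded lattice. -/
def IsBoolElem (e : A) : Prop := ∃ f : A, e ⊔ f = ⊤ ∧ e ⊓ f = ⊥

/-- A filter of a residuated lattice. -/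
def IsRLFilter (F : Set A) : Prop :=
  F.Nonempty ∧ (∀ a b : A, a ∈ F → b ∈ F → a * b ∈ F) ∧ (∀ a b : A, a ∈ F → a ≤ b → b ∈ F)

/-- The principal filter [x) = {a | xⁿ ≤ a for some n ≥ 1}. -/
def princ (x : A) : Set A := {a : A | ∃ n : ℕ, 1 ≤ n ∧ x ^ n ≤ a}

/-- A filter F has the Boolean Lifting Property. -/
def HasBLP (F : Set A) : Prop :=
  ∀ a : A, a ⊔ rneg a ∈ F → ∃ e : A, IsBoolElem e ∧ bires a e ∈ F

/-- A filter F has the Idempotent Lifting Property. -/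
def HasILP (F : Set A) : Prop :=
  ∀ a : A, bires a (a * a) ∈ F → ∃ e : A, e * e = e ∧ bires a e ∈ F

/-- A proper filter. -/
def IsProperRLFilter (F : Set A) : Prop := IsRLFilter F ∧ F ≠ Set.univ

/-- A maximal filter: a proper filter maximal under inclusion among proper filters. -/
def IsMaxRLFilter (M : Set A) : Prop :=
  IsProperRLFilter M ∧ ∀ G : Set A, IsProperRLFilter G → M ⊆ G → G = M

/-- A prime filter: a proper filter P with a ∨ b ∈ P → a ∈ P or b ∈ P. -/
def IsPrimeRLFilter (P : Set A) : Prop :=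
  IsProperRLFilter P ∧ ∀ a b : A, a ⊔ b ∈ P → a ∈ P ∨ b ∈ P

/-- The radical: intersection of all maximal filters. -/
def rad (A : Type*) [ResiduatedLattice A] : Set A :=
  {a : A | ∀ M : Set A, IsMaxRLFilter M → a ∈ M}

/-- v(a) = set of maximal filters containing a. -/
def vset (a : A) : Set (Set A) := {M : Set A | IsMaxRLFilter M ∧ a ∈ M}

/-- d(a) = set of maximal filters not containing a. -/
def dset (a : A) : Set (Set A) := {M : Set A | IsMaxRLFilter M ∧ a ∉ M}

/-- An element is nilpotent iff some positive power of it is 0. -/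
def RLNilpotent (a : A) : Prop := ∃ n : ℕ, 1 ≤ n ∧ a ^ n = ⊥

/-- The join F ∨ G of two filters: the smallest filter including F ∪ G. -/
def filtJoin (F G : Set A) : Set A := ⋂₀ {H : Set A | IsRLFilter H ∧ F ∪ G ⊆ H}

end ResiduatedLattice

namespace ResiduatedLattice

section Aux

variable {A : Type*} [ResiduatedLattice A]

theorem aux_mul_le_mul_right {a b : A} (h : a ≤ b) (c : A) : a * c ≤ b * c :=
  (residuation a c (b * c)).1 (h.trans ((residuation b c (b * c)).2 le_rfl))

theorem aux_mul_le_mul {a b c d : A} (h : a ≤ b) (h' : c ≤ d) : a * c ≤ b * d := by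
  refine (aux_mul_le_mul_right h c).trans ?_
  rw [mul_comm b c, mul_comm b d]
  exact aux_mul_le_mul_right h' b

theorem aux_le_one (a : A) : a ≤ 1 := by
  rw [one_eq_top]; exact le_top

theorem aux_mul_le_left (a b : A) : a * b ≤ a := by
  simpa using aux_mul_le_mul (le_refl a) (aux_le_one b)

theorem aux_mul_le_right (a b : A) : a * b ≤ b := by
  simpa using aux_mul_le_mul (aux_le_one a) (le_refl b)

theorem aux_pow_le_pow {a b : A} (h : a ≤ b) (n : ℕ) : a ^ n ≤ b ^ n := by
  induction n with
  | zero => simp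
  | succ k ih => rw [pow_succ, pow_succ]; exact aux_mul_le_mul ih h

theorem aux_pow_le_self {n : ℕ} (hn : 1 ≤ n) (a : A) : a ^ n ≤ a := by
  obtain ⟨k, rfl⟩ := Nat.exists_eq_add_of_le' hn
  rw [pow_succ]; exact aux_mul_le_right _ _

theorem aux_sup_mul_le {x y z c : A} (h1 : x * z ≤ c) (h2 : y * z ≤ c) : (x ⊔ y) * z ≤ c :=
  (residuation _ _ _).1 (sup_le ((residuation _ _ _).2 h1) ((residuation _ _ _).2 h2))

theorem aux_mul_rneg (a : A) : a * rneg a = ⊥ := by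
  rw [mul_comm]
  exact le_bot_iff.1 ((residuation _ _ _).1 (le_refl (rneg a)))

theorem aux_sup_pow_le {a b : A} (h : a * b = ⊥) (n : ℕ) : (a ⊔ b) ^ n ≤ a ^ n ⊔ b ^ n := by
  induction n with
  | zero => simp
  | succ k ih =>
    rcases Nat.eq_zero_or_pos k with rfl | hk
    · simp
    · rw [pow_succ]
      refine (aux_mul_le_mul_right ih _).trans (aux_sup_mul_le ?_ ?_)
      · rw [mul_comm]
        refine aux_sup_mul_le ?_ ?_
        · rw [← pow_succ']; exact le_sup_left
        · rw [mul_comm]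
          exact (aux_mul_le_mul_right (aux_pow_le_self hk a) b).trans (h.le.trans bot_le)
      · rw [mul_comm]
        refine aux_sup_mul_le ?_ ?_
        · rw [mul_comm]
          refine (aux_mul_le_mul_right (aux_pow_le_self hk b) a).trans ?_
          rw [mul_comm, h]; exact bot_le
        · rw [← pow_succ']; exact le_sup_right

theorem aux_princ_filter (x : A) : IsRLFilter (princ x) := by
  refine ⟨⟨x, 1, le_rfl, by simp⟩, ?_, ?_⟩
  · rintro a b ⟨n, hn, h⟩ ⟨m, hm, h'⟩
    exact ⟨n + m, by omega, by rw [pow_add]; exact aux_mul_le_mul h h'⟩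
  · rintro a b ⟨n, hn, h⟩ hab
    exact ⟨n, hn, h.trans hab⟩

theorem aux_pow_mem {F : Set A} (hF : IsRLFilter F) {a : A} (ha : a ∈ F) {n : ℕ} (hn : 1 ≤ n) :
    a ^ n ∈ F := by
  induction n, hn using Nat.le_induction with
  | base => simpa using ha
  | succ k hk ih => rw [pow_succ]; exact hF.2.1 _ _ ih ha

end Aux

end ResiduatedLattice

open ResiduatedLattice in
theorem stmt_4 {A : Type*} [ResiduatedLattice A] :
    List.TFAE
      [ ∀ F : Set A, IsRLFilter F → HasBLP F,
        ∀ x : A, ∃ e : A, IsBoolElem e ∧ e ∈ princ x ∧ rneg e ∈ princ (rneg x),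
        ∀ x y : A, x * y = ⊥ →
          ∃ e : A, IsBoolElem e ∧ e ∈ princ x ∧ rneg e ∈ princ y ] := by
  tfae_have 1 → 2 := by
    intro h x
    obtain ⟨e, he, n, hn, hle⟩ := h (princ (x ⊔ rneg x)) (aux_princ_filter _) x
      ⟨1, le_rfl, by simp⟩
    refine ⟨e, he, ⟨n + 1, by omega, ?_⟩, ⟨n + 1, by omega, ?_⟩⟩
    · rw [pow_succ]
      exact (residuation _ _ _).1
        ((aux_pow_le_pow le_sup_left n).trans (hle.trans inf_le_left))
    · refine (residuation _ _ _).2 ?_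
      have h1 : rneg x ^ n * e ≤ x := (residuation _ _ _).1
        ((aux_pow_le_pow le_sup_right n).trans (hle.trans inf_le_right))
      rw [pow_succ, mul_right_comm]
      exact (aux_mul_le_mul_right h1 _).trans (aux_mul_rneg x).le
  tfae_have 2 → 3 := by
    intro h x y hxy
    obtain ⟨e, he, h1, n, hn, h2⟩ := h x
    refine ⟨e, he, h1, n, hn, (aux_pow_le_pow ?_ n).trans h2⟩
    exact (residuation _ _ _).2 (by rw [mul_comm]; exact hxy.le)
  tfae_have 3 → 1 := by
    intro h F hF a ha
    obtain ⟨e, he, ⟨n, hn, h1⟩, m, hm, h2⟩ := h a (rneg a) (aux_mul_rneg a)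
    refine ⟨e, he, hF.2.2 _ _
      (hF.2.1 _ _ (aux_pow_mem hF ha hn) (aux_pow_mem hF ha hm)) (le_inf ?_ ?_)⟩
    · refine (aux_mul_le_left _ _).trans
        ((aux_sup_pow_le (aux_mul_rneg a) n).trans (sup_le ?_ ?_))
      · exact (residuation _ _ _).2 ((aux_mul_le_left _ _).trans h1)
      · refine (aux_pow_le_self hn _).trans ((residuation _ _ _).2 ?_)
        rw [mul_comm, aux_mul_rneg]; exact bot_le
    · refine (aux_mul_le_right _ _).trans
        ((aux_sup_pow_le (aux_mul_rneg a) m).trans (sup_le ?_ ?_))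
      · exact (residuation _ _ _).2 ((aux_mul_le_left _ _).trans (aux_pow_le_self hm a))
      · refine h2.trans ((residuation _ _ _).2 ?_)
        rw [mul_comm, aux_mul_rneg]; exact bot_le
  tfae_finish
end

section
/- For any residuated lattice A and any a ∈ A, d(a) equals the union over all integers n ≥ 1 of the sets v(¬(aⁿ)). -/
namespace ResiduatedLattice

theorem rl_mul_mono {A : Type*} [ResiduatedLattice A] {a b c d : A} (h : a ≤ b) (h' : c ≤ d) :
    a * c ≤ b * d := by
  have key : ∀ x y z : A, x ≤ y → x * z ≤ y * z := fun x y z hxy =>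
    (residuation x z (y * z)).1 (hxy.trans ((residuation y z (y * z)).2 le_rfl))
  refine (key a b c h).trans ?_
  rw [mul_comm b c, mul_comm b d]
  exact key c d b h'

theorem rl_le_one {A : Type*} [ResiduatedLattice A] (a : A) : a ≤ 1 := by
  rw [one_eq_top]; exact le_top

theorem rl_mul_le_left {A : Type*} [ResiduatedLattice A] (a b : A) : a * b ≤ a := by
  simpa using rl_mul_mono (le_refl a) (rl_le_one b)

theorem rl_one_mem {A : Type*} [ResiduatedLattice A] {F : Set A} (h : IsRLFilter F) :
    (1 : A) ∈ F := by
  obtain ⟨⟨x, hx⟩, -, h3⟩ := h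
  exact h3 x 1 hx (rl_le_one x)

theorem rl_pow_mem {A : Type*} [ResiduatedLattice A] {F : Set A} (h : IsRLFilter F) {a : A}
    (ha : a ∈ F) (n : ℕ) : a ^ n ∈ F := by
  induction n with
  | zero => simpa using rl_one_mem h
  | succ k ih => rw [pow_succ]; exact h.2.1 _ _ ih ha

theorem rl_bot_notMem {A : Type*} [ResiduatedLattice A] {F : Set A} (h : IsProperRLFilter F) :
    (⊥ : A) ∉ F := fun hb =>
  h.2 (Set.eq_univ_of_forall fun x => h.1.2.2 _ x hb bot_le)

end ResiduatedLattice

open ResiduatedLattice in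
theorem stmt_10 {A : Type*} [ResiduatedLattice A] (a : A) :
    dset a = ⋃ n ∈ {n : ℕ | 1 ≤ n}, vset (rneg (a ^ n)) := by
  ext M
  simp only [dset, vset, Set.mem_iUnion, Set.mem_setOf_eq, exists_prop]
  constructor
  · rintro ⟨hM, ha⟩
    by_contra hcon
    have hne : ∀ m ∈ M, ∀ n : ℕ, ¬ m * a ^ n ≤ ⊥ := by
      intro m hm n hmn
      apply hcon
      refine ⟨n + 1, by omega, hM, hM.1.1.2.2 m _ hm ((residuation _ _ _).2 ?_)⟩
      rw [pow_succ, ← mul_assoc]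
      exact (rl_mul_le_left _ _).trans hmn
    have hG : IsProperRLFilter {x : A | ∃ m ∈ M, ∃ n : ℕ, m * a ^ n ≤ x} := by
      refine ⟨⟨⟨1, 1, rl_one_mem hM.1.1, 0, by simp⟩, ?_, ?_⟩, ?_⟩
      · rintro x y ⟨m, hm, n, h⟩ ⟨m', hm', n', h'⟩
        refine ⟨m * m', hM.1.1.2.1 _ _ hm hm', n + n', ?_⟩
        rw [pow_add, mul_mul_mul_comm]
        exact rl_mul_mono h h'
      · rintro x y ⟨m, hm, n, h⟩ hxy
        exact ⟨m, hm, n, h.trans hxy⟩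
      · intro hU
        have hb : (⊥ : A) ∈ {x : A | ∃ m ∈ M, ∃ n : ℕ, m * a ^ n ≤ x} := by
          rw [hU]; trivial
        obtain ⟨m, hm, n, h⟩ := hb
        exact hne m hm n h
    have hEq := hM.2 _ hG (fun x hx => ⟨x, hx, 0, by simp⟩)
    apply ha
    rw [← hEq]
    exact ⟨1, rl_one_mem hM.1.1, 1, by simp⟩
  · rintro ⟨n, -, hM, hn⟩
    refine ⟨hM, fun ha => rl_bot_notMem hM.1 ?_⟩
    exact hM.1.1.2.2 _ _ (hM.1.1.2.1 _ _ hn (rl_pow_mem hM.1.1 ha n))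
      ((residuation _ _ _).1 le_rfl)
end
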